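/- arXiv:1812.01933 — 2 statements merged into one kernel-verified Lean document; each statement's English description precedes it below -/
import Mathlib

section
/- Let n ≥ 1 be an integer, 1 < p < ∞, T > 0, K₂ > 0, and let f : [0,∞) → [0,∞) be a locally integrable function with f(u) ≥ K₂ u^p for all u ≥ 0. Let ϑ₀ : ℝⁿ → [0,∞] be measurable and let ϑ : [0,T] × ℝⁿ → [0,∞] be measurable with ϑ(t,x) < ∞ for almost every (t,x) ∈ [0,T] × ℝⁿ, and suppose that ϑ(t,x) ≥ (e^{−tΔ}ϑ₀)(x) + ∫₀ᵗ (e^{−(t−s)Δ} f(ϑ(s,·)))(x) ds for almost every (t,x) ∈ [0,T] × ℝⁿ. Then for every t ∈ (0,T], t^{1/(p−1)} ‖e^{−tΔ}ϑ₀‖_{L^∞(ℝⁿ)} ≤ (K₂(p−1))^{−1/(p−1)}. -/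
open MeasureTheory Real ENNReal

/-- The Gaussian heat kernel `h_t(x) = (4πt)^(-n/2) exp(-‖x‖²/(4t))` on `ℝⁿ`. -/
noncomputable def heatKernel (n : ℕ) (t : ℝ) (x : EuclideanSpace ℝ (Fin n)) : ℝ :=
  (4 * Real.pi * t) ^ (-(n : ℝ) / 2) * Real.exp (-‖x‖ ^ 2 / (4 * t))

/-- The heat semigroup `e^{-tΔ}` acting on nonnegative extended-real-valued functions:
`(e^{-tΔ}v)(x) = ∫ h_t(x-y) v(y) dy` for `t ≠ 0`, and the identity at `t = 0`. -/
noncomputable def heatSem (n : ℕ) (t : ℝ) (v : EuclideanSpace ℝ (Fin n) → ℝ≥0∞)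
    (x : EuclideanSpace ℝ (Fin n)) : ℝ≥0∞ :=
  if t = 0 then v x else ∫⁻ y, ENNReal.ofReal (heatKernel n t (x - y)) * v y

/-- Jensen's inequality for real powers of `ℝ≥0∞`-valued functions on a probability space. -/
lemma lintegral_rpow_le_of_isProbabilityMeasure {α : Type*} [MeasurableSpace α] (μ : Measure α)
    [IsProbabilityMeasure μ] {p : ℝ} (hp : 1 ≤ p) {g : α → ℝ≥0∞} (hg : Measurable g) :
    (∫⁻ a, g a ∂μ) ^ p ≤ ∫⁻ a, g a ^ p ∂μ := by
  have h := eLpNorm'_le_eLpNorm'_of_exponent_le (f := g) one_pos hp μ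
    hg.aestronglyMeasurable
  simp only [eLpNorm', enorm_eq_self, ENNReal.rpow_one, div_one] at h
  calc (∫⁻ a, g a ∂μ) ^ p ≤ ((∫⁻ a, g a ^ p ∂μ) ^ (1 / p)) ^ p := by gcongr
    _ = ∫⁻ a, g a ^ p ∂μ := by
      rw [← ENNReal.rpow_mul, one_div, inv_mul_cancel₀ (by linarith), ENNReal.rpow_one]

/-- A monotone solution of the integral inequality `F ≥ A + K ∫ F ^ p` on `[0, t]` can only exist
up to the blow-up time of the corresponding ordinary differential equation. -/
lemma mul_le_rpow_of_integral_inequality {p K A t : ℝ} (hp : 1 < p) (hK : 0 < K) (hA : 0 < A)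
    (ht : 0 ≤ t) {F : ℝ → ℝ} (hF0 : ∀ s, 0 ≤ F s) (hmono : Monotone F)
    (hF : ∀ s ∈ Set.Icc 0 t, A + K * ∫ r in (0 : ℝ)..s, F r ^ p ≤ F s) :
    K * (p - 1) * t ≤ A ^ (1 - p) := by
  have hint (a b : ℝ) : IntervalIntegrable (fun r => F r ^ p) volume a b :=
    Monotone.intervalIntegrable fun x y hxy =>
      Real.rpow_le_rpow (hF0 x) (hmono hxy) (by linarith)
  set H : ℝ → ℝ := fun s => A + K * ∫ r in (0 : ℝ)..s, F r ^ p with hH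
  have hHc : Continuous H :=
    continuous_const.add (continuous_const.mul (intervalIntegral.continuous_primitive hint 0))
  have hHpos : ∀ s, 0 ≤ s → A ≤ H s := fun s hs => by
    have : 0 ≤ ∫ r in (0 : ℝ)..s, F r ^ p :=
      intervalIntegral.integral_nonneg hs fun r _ => Real.rpow_nonneg (hF0 r) p
    have := mul_nonneg hK.le this
    simp only [hH]; linarith
  have hHpc : Continuous fun s => H s ^ p :=
    hHc.rpow_const fun _ => Or.inr (by linarith)
  set J : ℝ → ℝ := fun s => A + K * ∫ r in (0 : ℝ)..s, H r ^ p with hJ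
  have hJd (s : ℝ) : HasDerivAt J (K * H s ^ p) s :=
    ((hHpc.integral_hasStrictDerivAt 0 s).hasDerivAt.const_mul K).const_add A
  have hJpos : ∀ s, 0 ≤ s → A ≤ J s := fun s hs => by
    have : 0 ≤ ∫ r in (0 : ℝ)..s, H r ^ p :=
      intervalIntegral.integral_nonneg hs fun r hr =>
        Real.rpow_nonneg (hA.le.trans (hHpos r hr.1)) p
    have := mul_nonneg hK.le this
    simp only [hJ]; linarith
  have hJH : ∀ s ∈ Set.Icc 0 t, J s ≤ H s := fun s hs => by
    have : ∫ r in (0 : ℝ)..s, H r ^ p ≤ ∫ r in (0 : ℝ)..s, F r ^ p :=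
      intervalIntegral.integral_mono_on hs.1 (hHpc.intervalIntegrable _ _) (hint _ _)
        fun r hr => Real.rpow_le_rpow (hA.le.trans (hHpos r hr.1))
          (hF r ⟨hr.1, hr.2.trans hs.2⟩) (by linarith)
    simp only [hH, hJ]; gcongr
  have hφd : ∀ s, 0 ≤ s → HasDerivAt (fun s => J s ^ (1 - p) + K * (p - 1) * s)
      (K * H s ^ p * (1 - p) * J s ^ (1 - p - 1) + K * (p - 1)) s := fun s hs => by
    have h1 := (hJd s).rpow_const (p := 1 - p) (Or.inl (hA.trans_le (hJpos s hs)).ne')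
    simpa using HasDerivAt.fun_add h1 ((hasDerivAt_id' s).const_mul (K * (p - 1)))
  have hanti : AntitoneOn (fun s => J s ^ (1 - p) + K * (p - 1) * s) (Set.Icc 0 t) := by
    refine antitoneOn_of_deriv_nonpos (convex_Icc 0 t)
      (fun s hs => (hφd s hs.1).continuousAt.continuousWithinAt)
      (fun s hs => (hφd s (interior_subset hs).1).differentiableAt.differentiableWithinAt) ?_
    intro s hs
    replace hs := interior_subset hs
    rw [(hφd s hs.1).deriv]
    have hJs := hA.trans_le (hJpos s hs.1)
    have h1 : 1 ≤ H s ^ p * J s ^ (1 - p - 1) := by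
      calc (1 : ℝ) = J s ^ p * J s ^ (1 - p - 1) := by
            rw [← Real.rpow_add hJs]; ring_nf; simp
        _ ≤ _ := by
            gcongr
            exact hJH s hs
    have h2 : 0 < K * (p - 1) := mul_pos hK (by linarith)
    nlinarith
  have h0t := hanti (Set.left_mem_Icc.2 ht) (Set.right_mem_Icc.2 ht) ht
  have hJ0 : J 0 = A := by simp [hJ]
  have := Real.rpow_nonneg (hA.le.trans (hJpos t ht)) (1 - p)
  simp only [hJ0, mul_zero, add_zero] at h0t
  linarith

/-- The `ℝ≥0∞`-valued form of `mul_le_rpow_of_integral_inequality`. -/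
lemma le_rpow_of_lintegral_inequality {p K t : ℝ} {A : ℝ≥0∞} (hp : 1 < p) (hK : 0 < K)
    (ht : 0 < t) {G : ℝ → ℝ≥0∞} (hmono : Monotone G) (hfin : G t ≠ ⊤)
    (hG : ∀ s ∈ Set.Icc 0 t, A + ∫⁻ r in Set.Ioo 0 s, ENNReal.ofReal K * G r ^ p ≤ G s) :
    A ≤ ENNReal.ofReal ((K * (p - 1) * t) ^ (-(1 / (p - 1)))) := by
  rcases eq_or_ne A 0 with rfl | hA0
  · exact zero_le
  have hAfin : A ≠ ⊤ :=
    ne_top_of_le_ne_top hfin (le_self_add.trans (hG t ⟨ht.le, le_rfl⟩))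
  have hApos : 0 < A.toReal := ENNReal.toReal_pos hA0 hAfin
  have hGfin (s : ℝ) : G (min s t) ≠ ⊤ := ne_top_of_le_ne_top hfin (hmono (min_le_right _ _))
  have hFmono : Monotone fun s => (G (min s t)).toReal := fun a b hab =>
    ENNReal.toReal_mono (hGfin b) (hmono (min_le_min_right _ hab))
  have hmain := mul_le_rpow_of_integral_inequality hp hK hApos ht.le
    (F := fun s => (G (min s t)).toReal) (fun s => ENNReal.toReal_nonneg) hFmono ?_
  · have hc : 0 < K * (p - 1) * t := mul_pos (mul_pos hK (by linarith)) ht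
    rw [← ENNReal.ofReal_toReal hAfin]
    apply ENNReal.ofReal_le_ofReal
    have hq : -(1 / (p - 1)) ≤ 0 := by
      rw [neg_nonpos]; exact one_div_nonneg.2 (by linarith)
    have h := Real.rpow_le_rpow_of_nonpos hc hmain hq
    rwa [← Real.rpow_mul hApos.le, show (1 - p) * -(1 / (p - 1)) = 1 by
      have : p - 1 ≠ 0 := by linarith
      field_simp; ring, Real.rpow_one] at h
  · intro s hs
    have hmeas : Measurable fun r => (G (min r t)).toReal ^ p :=
      (hFmono.measurable).pow_const p
    have hnn (r : ℝ) : 0 ≤ K * (G (min r t)).toReal ^ p := by positivity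
    have hint : K * ∫ r in (0 : ℝ)..s, (G (min r t)).toReal ^ p
        = (∫⁻ r in Set.Ioo 0 s, ENNReal.ofReal K * G r ^ p).toReal := by
      rw [← intervalIntegral.integral_const_mul, intervalIntegral.integral_of_le hs.1,
        integral_Ioc_eq_integral_Ioo,
        integral_eq_lintegral_of_nonneg_ae (.of_forall hnn)
          (hmeas.const_mul K).aestronglyMeasurable]
      congr 1
      refine setLIntegral_congr_fun measurableSet_Ioo fun r hr => ?_
      have hr' : min r t = r := min_eq_left (hr.2.le.trans hs.2)
      have := hGfin r
      simp only [hr'] at this ⊢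
      rw [ENNReal.ofReal_mul hK.le, ← ENNReal.ofReal_rpow_of_nonneg ENNReal.toReal_nonneg
        (by linarith), ENNReal.ofReal_toReal this]
    have hGs : G s ≠ ⊤ := by simpa [min_eq_left hs.2] using hGfin s
    rw [hint, ← ENNReal.toReal_add hAfin (ne_top_of_le_ne_top hGs (le_add_self.trans (hG s hs))),
      min_eq_left hs.2]
    exact ENNReal.toReal_mono hGs (hG s hs)

section HeatSemigroup

variable {n : ℕ}

lemma heatKernel_nonneg {t : ℝ} (ht : 0 < t) (x : EuclideanSpace ℝ (Fin n)) :
    0 ≤ heatKernel n t x := by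
  unfold heatKernel; positivity

lemma measurable_heatKernel :
    Measurable fun q : ℝ × EuclideanSpace ℝ (Fin n) => heatKernel n q.1 q.2 := by
  unfold heatKernel; fun_prop

lemma heatSem_of_pos {t : ℝ} (ht : 0 < t) (v : EuclideanSpace ℝ (Fin n) → ℝ≥0∞)
    (x : EuclideanSpace ℝ (Fin n)) :
    heatSem n t v x = ∫⁻ y, ENNReal.ofReal (heatKernel n t (x - y)) * v y :=
  if_neg ht.ne'

lemma lintegral_heatKernel {t : ℝ} (ht : 0 < t) :
    ∫⁻ y : EuclideanSpace ℝ (Fin n), ENNReal.ofReal (heatKernel n t y) = 1 := by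
  have hb : 0 < (4 * t)⁻¹ := by positivity
  have hG := GaussianFourier.integral_rexp_neg_mul_sq_norm
    (V := EuclideanSpace ℝ (Fin n)) hb
  have hpos : 0 < (Real.pi / (4 * t)⁻¹) ^ ((n : ℝ) / 2) := by positivity
  rw [finrank_euclideanSpace_fin] at hG
  have hker (y : EuclideanSpace ℝ (Fin n)) : heatKernel n t y
      = (4 * Real.pi * t) ^ (-(n : ℝ) / 2) * Real.exp (-(4 * t)⁻¹ * ‖y‖ ^ 2) := by
    unfold heatKernel
    congr 2
    field_simp
  have hint : Integrable fun y : EuclideanSpace ℝ (Fin n) => heatKernel n t y := by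
    simp only [hker]
    exact (Integrable.of_integral_ne_zero (hG ▸ hpos.ne')).const_mul _
  rw [← ofReal_integral_eq_lintegral_ofReal hint (.of_forall (heatKernel_nonneg ht))]
  simp only [hker]
  rw [integral_const_mul, hG, show Real.pi / (4 * t)⁻¹ = 4 * Real.pi * t by field_simp,
    ← Real.rpow_add (by positivity)]
  ring_nf
  simp

lemma heatKernel_mul_heatKernel {a b : ℝ} (ha : 0 < a) (hb : 0 < b)
    (X Y : EuclideanSpace ℝ (Fin n)) :
    heatKernel n a (X - Y) * heatKernel n b Y
      = heatKernel n (a + b) X * heatKernel n (a * b / (a + b)) (Y - (b / (a + b)) • X) := by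
  unfold heatKernel
  have hconst : (4 * Real.pi * a) ^ (-(n : ℝ) / 2) * (4 * Real.pi * b) ^ (-(n : ℝ) / 2)
      = (4 * Real.pi * (a + b)) ^ (-(n : ℝ) / 2)
        * (4 * Real.pi * (a * b / (a + b))) ^ (-(n : ℝ) / 2) := by
    rw [← Real.mul_rpow (by positivity) (by positivity),
      ← Real.mul_rpow (by positivity) (by positivity)]
    congr 1
    field_simp
  have hexp : -‖X - Y‖ ^ 2 / (4 * a) + -‖Y‖ ^ 2 / (4 * b)
      = -‖X‖ ^ 2 / (4 * (a + b))
        + -‖Y - (b / (a + b)) • X‖ ^ 2 / (4 * (a * b / (a + b))) := by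
    rw [norm_sub_sq_real, norm_sub_sq_real, inner_smul_right, norm_smul, mul_pow,
      Real.norm_eq_abs, sq_abs, real_inner_comm Y X]
    field_simp
    ring
  rw [mul_mul_mul_comm, hconst, ← Real.exp_add, hexp, Real.exp_add, mul_mul_mul_comm]

lemma lintegral_heatKernel_mul_heatKernel {a b : ℝ} (ha : 0 < a) (hb : 0 < b)
    (x z : EuclideanSpace ℝ (Fin n)) :
    ∫⁻ y, ENNReal.ofReal (heatKernel n a (x - y)) * ENNReal.ofReal (heatKernel n b (y - z))
      = ENNReal.ofReal (heatKernel n (a + b) (x - z)) := by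
  have hab : 0 < a + b := add_pos ha hb
  have h (y : EuclideanSpace ℝ (Fin n)) :
      ENNReal.ofReal (heatKernel n a (x - y)) * ENNReal.ofReal (heatKernel n b (y - z))
      = ENNReal.ofReal (heatKernel n (a + b) (x - z)) * ENNReal.ofReal
        (heatKernel n (a * b / (a + b)) (y - (z + (b / (a + b)) • (x - z)))) := by
    rw [← ENNReal.ofReal_mul (heatKernel_nonneg ha _),
      ← ENNReal.ofReal_mul (heatKernel_nonneg hab _), ← sub_sub,
      ← heatKernel_mul_heatKernel ha hb, sub_sub_sub_cancel_right]
  simp only [h]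
  rw [lintegral_const_mul' _ _ ENNReal.ofReal_ne_top,
    lintegral_sub_right_eq_self (fun y => ENNReal.ofReal (heatKernel n (a * b / (a + b)) y)),
    lintegral_heatKernel (by positivity), mul_one]

lemma measurable_heatSem {α : Type*} [MeasurableSpace α] {τ : α → ℝ}
    {X : α → EuclideanSpace ℝ (Fin n)} {v : α → EuclideanSpace ℝ (Fin n) → ℝ≥0∞}
    (hτ : Measurable τ) (hX : Measurable X) (hv : Measurable (Function.uncurry v)) :
    Measurable fun a => heatSem n (τ a) (v a) (X a) := by
  unfold heatSem
  refine Measurable.ite (hτ (measurableSet_singleton 0)) (hv.comp (measurable_id.prodMk hX)) ?_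
  refine Measurable.lintegral_prod_right'
    (f := fun q : α × EuclideanSpace ℝ (Fin n) =>
      ENNReal.ofReal (heatKernel n (τ q.1) (X q.1 - q.2)) * v q.1 q.2) ?_
  refine Measurable.mul (ENNReal.measurable_ofReal.comp (measurable_heatKernel.comp
    ((hτ.comp measurable_fst).prodMk ((hX.comp measurable_fst).sub measurable_snd)))) hv

lemma measurable_ofReal_heatKernel_sub (t : ℝ) (x : EuclideanSpace ℝ (Fin n)) :
    Measurable fun y => ENNReal.ofReal (heatKernel n t (x - y)) :=
  ENNReal.measurable_ofReal.comp
    (measurable_heatKernel.comp (measurable_const.prodMk (measurable_const.sub measurable_id)))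

lemma heatSem_heatSem {a b : ℝ} (ha : 0 < a) (hb : 0 < b)
    {v : EuclideanSpace ℝ (Fin n) → ℝ≥0∞} (hv : Measurable v) (x : EuclideanSpace ℝ (Fin n)) :
    heatSem n a (heatSem n b v) x = heatSem n (a + b) v x := by
  rw [heatSem_of_pos ha, heatSem_of_pos (add_pos ha hb)]
  simp only [heatSem_of_pos hb]
  have hker : Measurable fun q : EuclideanSpace ℝ (Fin n) × EuclideanSpace ℝ (Fin n) =>
      ENNReal.ofReal (heatKernel n b (q.1 - q.2)) :=
    ENNReal.measurable_ofReal.comp (measurable_heatKernel.comp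
      (measurable_const.prodMk (measurable_fst.sub measurable_snd)))
  have hprod : Measurable fun q : EuclideanSpace ℝ (Fin n) × EuclideanSpace ℝ (Fin n) =>
      ENNReal.ofReal (heatKernel n a (x - q.1)) *
        (ENNReal.ofReal (heatKernel n b (q.1 - q.2)) * v q.2) :=
    ((measurable_ofReal_heatKernel_sub a x).comp measurable_fst).mul
      (hker.mul (hv.comp measurable_snd))
  calc _ = ∫⁻ y, ∫⁻ z, ENNReal.ofReal (heatKernel n a (x - y)) *
          (ENNReal.ofReal (heatKernel n b (y - z)) * v z) := by
        simp only [lintegral_const_mul' _ _ ENNReal.ofReal_ne_top]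
    _ = ∫⁻ z, ∫⁻ y, ENNReal.ofReal (heatKernel n a (x - y)) *
          (ENNReal.ofReal (heatKernel n b (y - z)) * v z) :=
        lintegral_lintegral_swap hprod.aemeasurable
    _ = _ := by
        refine lintegral_congr fun z => ?_
        simp only [← mul_assoc]
        have hm : Measurable fun y => ENNReal.ofReal (heatKernel n a (x - y))
            * ENNReal.ofReal (heatKernel n b (y - z)) :=
          (measurable_ofReal_heatKernel_sub a x).mul
            (ENNReal.measurable_ofReal.comp (measurable_heatKernel.comp
              (measurable_const.prodMk (measurable_id.sub measurable_const))))
        rw [lintegral_mul_const _ hm, lintegral_heatKernel_mul_heatKernel ha hb]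

lemma heatSem_mono_ae {t : ℝ} (ht : 0 < t) {v w : EuclideanSpace ℝ (Fin n) → ℝ≥0∞}
    (h : v ≤ᵐ[volume] w) (x : EuclideanSpace ℝ (Fin n)) : heatSem n t v x ≤ heatSem n t w x := by
  rw [heatSem_of_pos ht, heatSem_of_pos ht]
  refine lintegral_mono_ae ?_
  filter_upwards [h] with y hy
  gcongr

lemma heatSem_rpow_le {t p : ℝ} (ht : 0 < t) (hp : 1 ≤ p)
    {v : EuclideanSpace ℝ (Fin n) → ℝ≥0∞} (hv : Measurable v) (x : EuclideanSpace ℝ (Fin n)) :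
    heatSem n t v x ^ p ≤ heatSem n t (fun y => v y ^ p) x := by
  rw [heatSem_of_pos ht, heatSem_of_pos ht]
  have hk := measurable_ofReal_heatKernel_sub t x
  have : IsProbabilityMeasure
      (volume.withDensity fun y => ENNReal.ofReal (heatKernel n t (x - y))) := by
    constructor
    rw [withDensity_apply _ .univ, setLIntegral_univ,
      lintegral_sub_left_eq_self (fun y => ENNReal.ofReal (heatKernel n t y)),
      lintegral_heatKernel ht]
  have h := lintegral_rpow_le_of_isProbabilityMeasure
    (volume.withDensity fun y => ENNReal.ofReal (heatKernel n t (x - y))) hp hv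
  rwa [lintegral_withDensity_eq_lintegral_mul _ hk hv,
    lintegral_withDensity_eq_lintegral_mul _ hk (hv.pow_const p)] at h

lemma heatSem_const_mul {t : ℝ} (ht : 0 < t) {c : ℝ≥0∞} (hc : c ≠ ⊤)
    (v : EuclideanSpace ℝ (Fin n) → ℝ≥0∞) (x : EuclideanSpace ℝ (Fin n)) :
    heatSem n t (fun y => c * v y) x = c * heatSem n t v x := by
  rw [heatSem_of_pos ht, heatSem_of_pos ht, ← lintegral_const_mul' _ _ hc]
  simp only [mul_left_comm]

/-- The heat semigroup carries the Duhamel formula at time `s` to the one at time `t`, except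
that the time integral stops at `s`. -/
lemma heatSem_duhamel {s t : ℝ} (hs : 0 < s) (hst : s < t)
    {v : EuclideanSpace ℝ (Fin n) → ℝ≥0∞} (hv : Measurable v)
    {w : ℝ → EuclideanSpace ℝ (Fin n) → ℝ≥0∞} (hw : Measurable (Function.uncurry w))
    (x : EuclideanSpace ℝ (Fin n)) :
    heatSem n (t - s)
        (fun y => heatSem n s v y + ∫⁻ r in Set.Ioo 0 s, heatSem n (s - r) (w r) y) x
      = heatSem n t v x + ∫⁻ r in Set.Ioo 0 s, heatSem n (t - r) (w r) x := by
  have hts : 0 < t - s := sub_pos.2 hst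
  have hk := measurable_ofReal_heatKernel_sub (t - s) x
  have hsv : Measurable (heatSem n s v) :=
    measurable_heatSem measurable_const measurable_id (hv.comp measurable_snd)
  have hW : Measurable fun q : EuclideanSpace ℝ (Fin n) × ℝ =>
      heatSem n (s - q.2) (w q.2) q.1 :=
    measurable_heatSem (measurable_const.sub measurable_snd) measurable_fst
      (hw.comp ((measurable_snd.comp measurable_fst).prodMk measurable_snd))
  have hm : Measurable fun y =>
      ENNReal.ofReal (heatKernel n (t - s) (x - y)) * heatSem n s v y := hk.mul hsv
  rw [heatSem_of_pos hts]
  simp only [mul_add]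
  rw [lintegral_add_left hm, ← heatSem_of_pos hts, heatSem_heatSem hts hs hv,
    sub_add_cancel]
  congr 1
  calc _ = ∫⁻ y, ∫⁻ r in Set.Ioo 0 s,
          ENNReal.ofReal (heatKernel n (t - s) (x - y)) * heatSem n (s - r) (w r) y := by
        simp only [lintegral_const_mul' _ _ ENNReal.ofReal_ne_top]
    _ = ∫⁻ r in Set.Ioo 0 s, ∫⁻ y,
          ENNReal.ofReal (heatKernel n (t - s) (x - y)) * heatSem n (s - r) (w r) y :=
        lintegral_lintegral_swap ((hk.comp measurable_fst).mul hW).aemeasurable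
    _ = _ := by
        refine setLIntegral_congr_fun measurableSet_Ioo fun r hr => ?_
        have hwr : Measurable (w r) := hw.comp (measurable_const.prodMk measurable_id)
        rw [← heatSem_of_pos hts, heatSem_heatSem hts (sub_pos.2 hr.2) hwr, sub_add_sub_cancel]

/-- Joint lower semicontinuity of the heat evolution at positive times, in the form of
propagation of upper bounds. -/
lemma heatSem_le_of_mem_closure {v : EuclideanSpace ℝ (Fin n) → ℝ≥0∞} (hv : Measurable v)
    {S : Set (ℝ × EuclideanSpace ℝ (Fin n))} {B : ℝ → ℝ≥0∞} {t : ℝ} (ht : 0 < t)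
    {x : EuclideanSpace ℝ (Fin n)} (hB : ContinuousAt B t) (hmem : (t, x) ∈ closure S)
    (hS : ∀ q ∈ S, 0 < q.1 → heatSem n q.1 v q.2 ≤ B q.1) :
    heatSem n t v x ≤ B t := by
  have := mem_closure_iff_nhdsWithin_neBot.1 hmem
  set l := nhdsWithin (t, x) S
  have hl : l ≤ nhds (t, x) := nhdsWithin_le_nhds
  have hpos : ∀ᶠ q : ℝ × EuclideanSpace ℝ (Fin n) in l, 0 < q.1 :=
    hl (continuousAt_fst.eventually (lt_mem_nhds ht))
  have hlim (y : EuclideanSpace ℝ (Fin n)) : Filter.Tendsto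
      (fun q : ℝ × EuclideanSpace ℝ (Fin n) =>
        ENNReal.ofReal (heatKernel n q.1 (q.2 - y)) * v y) l
      (nhds (ENNReal.ofReal (heatKernel n t (x - y)) * v y)) := by
    have hk0 : 0 < heatKernel n t (x - y) := by unfold heatKernel; positivity
    have hk : ContinuousAt (fun q : ℝ × EuclideanSpace ℝ (Fin n) =>
        heatKernel n q.1 (q.2 - y)) (t, x) := by
      unfold heatKernel
      refine ContinuousAt.mul (ContinuousAt.rpow_const (by fun_prop) (Or.inl ?_))
        (Real.continuous_exp.continuousAt.comp (ContinuousAt.div (by fun_prop) (by fun_prop) ?_))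
      · positivity
      · positivity
    exact ENNReal.Tendsto.mul_const
      ((ENNReal.continuous_ofReal.tendsto _).comp (hk.mono_left hl))
      (Or.inl (ENNReal.ofReal_pos.2 hk0).ne')
  calc heatSem n t v x
      = ∫⁻ y, Filter.liminf (fun q : ℝ × EuclideanSpace ℝ (Fin n) =>
          ENNReal.ofReal (heatKernel n q.1 (q.2 - y)) * v y) l := by
        rw [heatSem_of_pos ht]
        exact lintegral_congr fun y => (hlim y).liminf_eq.symm
    _ ≤ Filter.liminf (fun q : ℝ × EuclideanSpace ℝ (Fin n) =>
          ∫⁻ y, ENNReal.ofReal (heatKernel n q.1 (q.2 - y)) * v y) l :=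
        lintegral_liminf_le fun q => (measurable_ofReal_heatKernel_sub q.1 q.2).mul hv
    _ ≤ Filter.liminf (fun q : ℝ × EuclideanSpace ℝ (Fin n) => B q.1) l := by
        refine Filter.liminf_le_liminf ?_
        filter_upwards [hpos, self_mem_nhdsWithin] with q hq hqS
        exact (heatSem_of_pos hq _ _).symm.trans_le (hS q hqS hq)
    _ = B t := ((hB.tendsto.comp continuousAt_fst.tendsto).mono_left hl).liminf_eq

/-- If `u` dominates its own Duhamel formula with source `K u ^ p`, then the linear part of that
formula is bounded at every point where the formula is finite. -/
lemma heatSem_le_of_duhamel_le {p T K : ℝ} (hp : 1 < p) (hK : 0 < K)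
    {v : EuclideanSpace ℝ (Fin n) → ℝ≥0∞} (hv : Measurable v)
    {u : ℝ → EuclideanSpace ℝ (Fin n) → ℝ≥0∞} (hu : Measurable (Function.uncurry u))
    (hsuper : ∀ᵐ s ∂volume.restrict (Set.Icc (0 : ℝ) T), ∀ᵐ y,
      heatSem n s v y + ∫⁻ r in Set.Ioo 0 s,
        heatSem n (s - r) (fun z => ENNReal.ofReal K * u r z ^ p) y ≤ u s y)
    {t : ℝ} (ht : 0 < t) (htT : t ≤ T) {x : EuclideanSpace ℝ (Fin n)}
    (hfin : heatSem n t v x + ∫⁻ r in Set.Ioo 0 t,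
        heatSem n (t - r) (fun z => ENNReal.ofReal K * u r z ^ p) x ≠ ⊤) :
    heatSem n t v x ≤ ENNReal.ofReal ((K * (p - 1) * t) ^ (-(1 / (p - 1)))) := by
  have hw : Measurable (Function.uncurry fun r z => ENNReal.ofReal K * u r z ^ p) :=
    (hu.pow_const p).const_mul _
  have hjensen : ∀ r ∈ Set.Ioo 0 t, ENNReal.ofReal K * heatSem n (t - r) (u r) x ^ p
      ≤ heatSem n (t - r) (fun z => ENNReal.ofReal K * u r z ^ p) x := fun r hr => by
    rw [heatSem_const_mul (sub_pos.2 hr.2) ENNReal.ofReal_ne_top]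
    gcongr
    exact heatSem_rpow_le (sub_pos.2 hr.2) hp.le
      (hu.comp (measurable_const.prodMk measurable_id)) x
  set G : ℝ → ℝ≥0∞ := fun s => heatSem n t v x
    + ∫⁻ r in Set.Ioo 0 s, heatSem n (t - r) (fun z => ENNReal.ofReal K * u r z ^ p) x with hG
  have hGmono : Monotone G := fun a b hab => by
    simp only [hG]
    gcongr
  refine le_rpow_of_lintegral_inequality hp hK ht hGmono hfin fun s hs => ?_
  simp only [hG]
  gcongr _ + ?_
  have hae : ∀ᵐ r ∂volume.restrict (Set.Ioo 0 s), ∀ᵐ y,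
      heatSem n r v y + ∫⁻ r' in Set.Ioo 0 r,
        heatSem n (r - r') (fun z => ENNReal.ofReal K * u r' z ^ p) y ≤ u r y :=
    ae_restrict_of_ae_restrict_of_subset
      (Set.Ioo_subset_Icc_self.trans (Set.Icc_subset_Icc_right (hs.2.trans htT))) hsuper
  refine lintegral_mono_ae ?_
  filter_upwards [hae, ae_restrict_mem measurableSet_Ioo] with r hr hrs
  have hrt : r < t := hrs.2.trans_le hs.2
  refine le_trans ?_ (hjensen r ⟨hrs.1, hrt⟩)
  gcongr
  rw [← heatSem_duhamel hrs.1 hrt hv hw]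
  exact heatSem_mono_ae (sub_pos.2 hrt) hr x

end HeatSemigroup

theorem decay_bound_of_supersolution
    (n : ℕ) (hn : 1 ≤ n) (p T K₂ : ℝ) (hp : 1 < p) (hT : 0 < T) (hK₂ : 0 < K₂)
    (f : ℝ → ℝ) (hf0 : ∀ u ≥ (0 : ℝ), 0 ≤ f u)
    (hfloc : LocallyIntegrableOn f (Set.Ici 0) volume)
    (hfK : ∀ u ≥ (0 : ℝ), K₂ * u ^ p ≤ f u)
    (ϑ₀ : EuclideanSpace ℝ (Fin n) → ℝ≥0∞) (hϑ₀ : Measurable ϑ₀)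
    (ϑ : ℝ → EuclideanSpace ℝ (Fin n) → ℝ≥0∞) (hϑ : Measurable (Function.uncurry ϑ))
    (hfin : ∀ᵐ q ∂((volume.restrict (Set.Icc (0 : ℝ) T)).prod
        (volume : Measure (EuclideanSpace ℝ (Fin n)))), ϑ q.1 q.2 < ⊤)
    (hsuper : ∀ᵐ q ∂((volume.restrict (Set.Icc (0 : ℝ) T)).prod
        (volume : Measure (EuclideanSpace ℝ (Fin n)))),
      heatSem n q.1 ϑ₀ q.2
        + (∫⁻ s in Set.Ioc (0 : ℝ) q.1,
            heatSem n (q.1 - s) (fun y => ENNReal.ofReal (f ((ϑ s y).toReal))) q.2)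
        ≤ ϑ q.1 q.2) :
    ∀ t : ℝ, 0 < t → t ≤ T →
      ENNReal.ofReal (t ^ (1 / (p - 1))) * essSup (heatSem n t ϑ₀) volume
        ≤ ENNReal.ofReal ((K₂ * (p - 1)) ^ (-(1 / (p - 1)))) := by
  intro t ht htT
  have hp1 : 0 < p - 1 := by linarith
  have hfK' : ∀ᵐ s ∂volume.restrict (Set.Icc (0 : ℝ) T), ∀ᵐ y,
      ENNReal.ofReal K₂ * ϑ s y ^ p ≤ ENNReal.ofReal (f (ϑ s y).toReal) := by
    filter_upwards [Measure.ae_ae_of_ae_prod hfin] with s hs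
    filter_upwards [hs] with y hy
    refine le_trans (le_of_eq ?_)
      (ENNReal.ofReal_le_ofReal (hfK (ϑ s y).toReal ENNReal.toReal_nonneg))
    rw [ENNReal.ofReal_mul hK₂.le, ← ENNReal.ofReal_rpow_of_nonneg ENNReal.toReal_nonneg
      (by linarith), ENNReal.ofReal_toReal hy.ne]
  have hpow : ∀ s ∈ Set.Icc 0 T, ∀ y,
      ∫⁻ r in Set.Ioo 0 s, heatSem n (s - r) (fun z => ENNReal.ofReal K₂ * ϑ r z ^ p) y
        ≤ ∫⁻ r in Set.Ioc 0 s,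
          heatSem n (s - r) (fun z => ENNReal.ofReal (f (ϑ r z).toReal)) y := by
    intro s hs y
    refine le_trans (lintegral_mono_ae ?_) (lintegral_mono_set Set.Ioo_subset_Ioc_self)
    filter_upwards [ae_restrict_of_ae_restrict_of_subset
      (Set.Ioo_subset_Icc_self.trans (Set.Icc_subset_Icc_right hs.2)) hfK', ae_restrict_mem measurableSet_Ioo]
      with r hr hrs
    exact heatSem_mono_ae (sub_pos.2 hrs.2) hr y
  have hIcc : ∀ᵐ q ∂((volume.restrict (Set.Icc (0 : ℝ) T)).prod
      (volume : Measure (EuclideanSpace ℝ (Fin n)))), q.1 ∈ Set.Icc 0 T :=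
    Measure.quasiMeasurePreserving_fst.ae (ae_restrict_mem measurableSet_Icc)
  have hsuper' : ∀ᵐ q ∂((volume.restrict (Set.Icc (0 : ℝ) T)).prod
      (volume : Measure (EuclideanSpace ℝ (Fin n)))),
      heatSem n q.1 ϑ₀ q.2 + ∫⁻ r in Set.Ioo 0 q.1,
        heatSem n (q.1 - r) (fun z => ENNReal.ofReal K₂ * ϑ r z ^ p) q.2 ≤ ϑ q.1 q.2 := by
    filter_upwards [hsuper, hIcc] with q hq hqI
    exact le_trans (add_le_add_right (hpow q.1 hqI q.2) _) hq
  have hgood : ∀ᵐ q ∂((volume.restrict (Set.Icc (0 : ℝ) T)).prod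
      (volume : Measure (EuclideanSpace ℝ (Fin n)))), 0 < q.1 →
      heatSem n q.1 ϑ₀ q.2
        ≤ ENNReal.ofReal ((K₂ * (p - 1) * q.1) ^ (-(1 / (p - 1)))) := by
    filter_upwards [hsuper', hfin, hIcc] with q hq hqf hqI hq0
    exact heatSem_le_of_duhamel_le hp hK₂ hϑ₀ hϑ (Measure.ae_ae_of_ae_prod hsuper') hq0 hqI.2
      (hq.trans_lt hqf).ne
  rw [← Measure.restrict_univ (μ := (volume : Measure (EuclideanSpace ℝ (Fin n)))),
    Measure.prod_restrict, ae_restrict_iff' (measurableSet_Icc.prod .univ)] at hgood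
  have hclosure (x : EuclideanSpace ℝ (Fin n)) : (t, x) ∈ closure
      ((Set.Ioo 0 T ×ˢ Set.univ) ∩ {q : ℝ × EuclideanSpace ℝ (Fin n) |
        q ∈ Set.Icc 0 T ×ˢ Set.univ → 0 < q.1 → heatSem n q.1 ϑ₀ q.2
          ≤ ENNReal.ofReal ((K₂ * (p - 1) * q.1) ^ (-(1 / (p - 1))))}) := by
    refine closure_minimal ((Measure.dense_of_ae hgood).open_subset_closure_inter
      (isOpen_Ioo.prod isOpen_univ)) isClosed_closure ?_
    rw [closure_prod_eq, closure_Ioo hT.ne, closure_univ]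
    exact ⟨⟨ht.le, htT⟩, trivial⟩
  have hbound (x : EuclideanSpace ℝ (Fin n)) : heatSem n t ϑ₀ x
      ≤ ENNReal.ofReal ((K₂ * (p - 1) * t) ^ (-(1 / (p - 1)))) := by
    refine heatSem_le_of_mem_closure hϑ₀
      (B := fun s => ENNReal.ofReal ((K₂ * (p - 1) * s) ^ (-(1 / (p - 1))))) ht ?_ (hclosure x)
      fun q hq hq0 => hq.2 ⟨⟨hq.1.1.1.le, hq.1.1.2.le⟩, trivial⟩ hq0
    exact ENNReal.continuous_ofReal.continuousAt.comp
      (ContinuousAt.rpow_const (by fun_prop) (Or.inl (by positivity)))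
  calc ENNReal.ofReal (t ^ (1 / (p - 1))) * essSup (heatSem n t ϑ₀) volume
      ≤ ENNReal.ofReal (t ^ (1 / (p - 1)))
        * ENNReal.ofReal ((K₂ * (p - 1) * t) ^ (-(1 / (p - 1)))) := by
        gcongr
        exact essSup_le_of_ae_le _ (.of_forall hbound)
    _ = ENNReal.ofReal ((K₂ * (p - 1)) ^ (-(1 / (p - 1)))) := by
        rw [← ENNReal.ofReal_mul (by positivity), Real.mul_rpow (by positivity) ht.le,
          mul_left_comm, ← Real.rpow_add ht, add_neg_cancel, Real.rpow_zero, mul_one]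
end

section
/- Let n ≥ 1 be an integer and let p = 1 + 2/n. Let K₂ > 0 and let f : [0,∞) → [0,∞) be a locally integrable function with f(u) ≥ K₂ u^p for all u ≥ 0. Let u₀ : ℝⁿ → [0,∞] be measurable and strictly positive on a set of positive Lebesgue measure. Then there is no measurable function u : [0,∞) × ℝⁿ → [0,∞] with u(t,x) < ∞ for almost every (t,x) ∈ (0,∞) × ℝⁿ satisfying, for every t > 0 and every x ∈ ℝⁿ, the integral equation u(t,x) = ∫_{ℝⁿ} h_t(x−y) u₀(y) dy + ∫₀ᵗ ∫_{ℝⁿ} h_{t−s}(x−y) f(u(s,y)) dy ds. -/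
open MeasureTheory Real ENNReal

/-- The heat kernel as an extended nonnegative function. -/
noncomputable def heatENN (n : ℕ) (t : ℝ) (x : EuclideanSpace ℝ (Fin n)) : ℝ≥0∞ :=
  ENNReal.ofReal (heatKernel n t x)

theorem measurable_heatENN (n : ℕ) :
    Measurable (fun q : ℝ × EuclideanSpace ℝ (Fin n) => heatENN n q.1 q.2) := by
  unfold heatENN heatKernel
  fun_prop

theorem lintegral_exp_neg_mul_sq_norm_sub {n : ℕ} {b : ℝ} (hb : 0 < b)
    (w : EuclideanSpace ℝ (Fin n)) :
    ∫⁻ y, ENNReal.ofReal (Real.exp (-b * ‖y - w‖ ^ 2)) =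
      ENNReal.ofReal ((Real.pi / b) ^ ((n : ℝ) / 2)) := by
  rw [lintegral_sub_right_eq_self (fun y => ENNReal.ofReal (Real.exp (-b * ‖y‖ ^ 2))) w]
  have h := GaussianFourier.integral_rexp_neg_mul_sq_norm
    (V := EuclideanSpace ℝ (Fin n)) hb
  rw [finrank_euclideanSpace_fin] at h
  rw [← h, ofReal_integral_eq_lintegral_ofReal]
  · by_contra hi
    rw [integral_undef hi] at h
    have : 0 < (Real.pi / b) ^ ((n : ℝ) / 2) := by positivity
    linarith
  · exact Filter.Eventually.of_forall fun y => (Real.exp_pos _).le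

theorem lintegral_heatENN_mul_heatENN {n : ℕ} {a b : ℝ} (ha : 0 < a) (hb : 0 < b)
    (x z : EuclideanSpace ℝ (Fin n)) :
    ∫⁻ y, heatENN n a (x - y) * heatENN n b (y - z) = heatENN n (a + b) (x - z) := by
  have hab : 0 < a + b := by positivity
  set w : EuclideanSpace ℝ (Fin n) := (b / (a + b)) • x + (a / (a + b)) • z with hw
  set β : ℝ := (a + b) / (4 * a * b) with hβ
  have hβ0 : 0 < β := by positivity
  have key : ∀ y, heatENN n a (x - y) * heatENN n b (y - z) =
      ENNReal.ofReal ((4 * Real.pi * a) ^ (-(n : ℝ) / 2) * (4 * Real.pi * b) ^ (-(n : ℝ) / 2) *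
        Real.exp (-‖x - z‖ ^ 2 / (4 * (a + b)))) *
      ENNReal.ofReal (Real.exp (-β * ‖y - w‖ ^ 2)) := by
    intro y
    unfold heatENN heatKernel
    rw [← ENNReal.ofReal_mul (by positivity), ← ENNReal.ofReal_mul (by positivity)]
    congr 1
    rw [mul_mul_mul_comm, mul_assoc _ (Real.exp _) (Real.exp _), ← Real.exp_add, ← Real.exp_add]
    congr 2
    have e1 : x - z = (x - y) + (y - z) := by abel
    have e2 : y - w = (-(b / (a + b))) • (x - y) + (a / (a + b)) • (y - z) := by
      have : y = (b / (a + b)) • y + (a / (a + b)) • y := by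
        rw [← add_smul, ← add_div, add_comm b a, div_self hab.ne', one_smul]
      rw [hw, smul_sub, smul_sub, neg_smul, neg_smul]
      nth_rewrite 1 [this]
      abel
    rw [e1, e2, norm_add_sq_real, norm_add_sq_real, norm_smul, norm_smul, inner_smul_left,
      inner_smul_right, mul_pow, mul_pow, Real.norm_eq_abs, Real.norm_eq_abs, sq_abs, sq_abs]
    simp only [conj_trivial, hβ]
    field_simp
    ring
  simp_rw [key]
  rw [lintegral_const_mul _ (by fun_prop), lintegral_exp_neg_mul_sq_norm_sub hβ0,
    ← ENNReal.ofReal_mul (by positivity)]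
  unfold heatENN heatKernel
  congr 1
  rw [mul_right_comm]
  congr 1
  rw [neg_div, Real.rpow_neg (by positivity), Real.rpow_neg (by positivity),
    Real.rpow_neg (by positivity), ← Real.inv_rpow (by positivity), ← Real.inv_rpow (by positivity),
    ← Real.inv_rpow (by positivity), ← Real.mul_rpow (by positivity) (by positivity),
    ← Real.mul_rpow (by positivity) (by positivity)]
  congr 1
  rw [hβ]
  field_simp

theorem lintegral_heatENN {n : ℕ} {t : ℝ} (ht : 0 < t) (x : EuclideanSpace ℝ (Fin n)) :
    ∫⁻ y, heatENN n t (x - y) = 1 := by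
  have h : ∀ y, heatENN n t (x - y) =
      ENNReal.ofReal ((4 * Real.pi * t) ^ (-(n : ℝ) / 2)) *
        ENNReal.ofReal (Real.exp (-(1 / (4 * t)) * ‖y - x‖ ^ 2)) := by
    intro y
    rw [← ENNReal.ofReal_mul (by positivity), heatENN, heatKernel, norm_sub_rev]
    congr 3
    ring
  simp_rw [h]
  rw [lintegral_const_mul _ (by fun_prop), lintegral_exp_neg_mul_sq_norm_sub (by positivity),
    ← ENNReal.ofReal_mul (by positivity), neg_div, Real.rpow_neg (by positivity)]
  have : Real.pi / (1 / (4 * t)) = 4 * Real.pi * t := by field_simp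
  rw [this, inv_mul_cancel₀ (by positivity), ENNReal.ofReal_one]

theorem rpow_lintegral_mul_le {α : Type*} [MeasurableSpace α] {μ : Measure α} {p : ℝ}
    (hp : 1 ≤ p) {h v : α → ℝ≥0∞} (hh : Measurable h) (hv : Measurable v)
    (hh1 : ∫⁻ y, h y ∂μ = 1) :
    (∫⁻ y, h y * v y ∂μ) ^ p ≤ ∫⁻ y, h y * v y ^ p ∂μ := by
  have hp0 : 0 < p := by linarith
  have hq : 0 ≤ 1 - 1 / p := by
    rw [sub_nonneg, div_le_one hp0]; exact hp
  have key := ENNReal.lintegral_mul_norm_pow_le (μ := μ) (f := fun y => h y * v y ^ p) (g := h)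
    (by fun_prop) hh.aemeasurable (p := 1 / p) (q := 1 - 1 / p) (by positivity) hq (by ring)
  rw [hh1, ENNReal.one_rpow, mul_one] at key
  have e : ∀ y, (h y * v y ^ p) ^ (1 / p) * h y ^ (1 - 1 / p) = h y * v y := by
    intro y
    rw [ENNReal.mul_rpow_of_nonneg _ _ (by positivity), ← ENNReal.rpow_mul,
      mul_one_div_cancel hp0.ne', ENNReal.rpow_one, mul_right_comm,
      ← ENNReal.rpow_add_of_nonneg _ _ (by positivity) hq]
    simp
  simp_rw [e] at key
  calc _ ≤ ((∫⁻ y, h y * v y ^ p ∂μ) ^ (1 / p)) ^ p := ENNReal.rpow_le_rpow key hp0.le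
    _ = _ := by rw [← ENNReal.rpow_mul, one_div_mul_cancel hp0.ne', ENNReal.rpow_one]

theorem ofReal_two_pow_mul_le_lintegral_Ioc {g : ℝ → ℝ≥0∞} {K q T : ℝ} (hK : 0 < K) (hq : 0 < q)
    (hg : ∀ τ, 0 < τ → τ < T → ENNReal.ofReal K * (∫⁻ s in Set.Ioc 0 τ, g s) ^ (1 + q) ≤ g τ)
    (k : ℕ) : ∀ s A : ℝ, 0 < s → s < T → 0 < A →
      1 ≤ K * A ^ q * (T - s) * (1 - 2 ^ (-q)) →
      ENNReal.ofReal A ≤ ∫⁻ τ in Set.Ioc 0 s, g τ →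
      ENNReal.ofReal (2 ^ k * A) ≤ ∫⁻ τ in Set.Ioc 0 T, g τ := by
  induction k with
  | zero =>
    intro s A hs hsT hA _ hW
    rw [pow_zero, one_mul]
    exact hW.trans (lintegral_mono_set (Set.Ioc_subset_Ioc_right hsT.le))
  | succ k ih =>
    intro s A hs hsT hA h1 hW
    have hAq : 0 < A ^ q := Real.rpow_pos_of_pos hA q
    have hδ : 0 < 1 / (K * A ^ q) := by positivity
    have hρ : (0 : ℝ) < 2 ^ (-q) := by positivity
    set s' := s + 1 / (K * A ^ q) with hs'
    have hs'T : s' < T := by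
      have h2 : 1 < K * A ^ q * (T - s) := by
        have : 0 < K * A ^ q * (T - s) := mul_pos (by positivity) (by linarith)
        nlinarith
      have : 1 / (K * A ^ q) < T - s := by
        rw [div_lt_iff₀ (by positivity)]; linarith
      linarith
    rw [pow_succ, mul_assoc]
    refine ih s' (2 * A) (by positivity) hs'T (by positivity) ?_ ?_
    · rw [Real.mul_rpow (by norm_num) hA.le]
      have e : K * (2 ^ q * A ^ q) * (T - s') * (1 - 2 ^ (-q)) =
          2 ^ q * (K * A ^ q * (T - s) * (1 - 2 ^ (-q)) - (1 - 2 ^ (-q))) := by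
        rw [hs']; field_simp; ring
      have e2 : (2 : ℝ) ^ q * 2 ^ (-q) = 1 := by
        rw [← Real.rpow_add (by norm_num)]; simp
      rw [e]
      calc (1 : ℝ) = 2 ^ q * 2 ^ (-q) := e2.symm
        _ ≤ _ := by gcongr; linarith
    · have hsplit : Set.Ioc 0 s' = Set.Ioc 0 s ∪ Set.Ioc s s' :=
        (Set.Ioc_union_Ioc_eq_Ioc hs.le (by linarith)).symm
      rw [hsplit, lintegral_union measurableSet_Ioc (Set.Ioc_disjoint_Ioc_of_le le_rfl), two_mul,
        ENNReal.ofReal_add hA.le hA.le]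
      refine add_le_add hW ?_
      calc ENNReal.ofReal A
          = ∫⁻ _ in Set.Ioc s s', ENNReal.ofReal (K * A ^ (1 + q)) := by
            rw [setLIntegral_const, Real.volume_Ioc, ← ENNReal.ofReal_mul (by positivity),
              Real.rpow_add hA, Real.rpow_one]
            congr 1
            rw [hs']; field_simp; ring
        _ ≤ _ := by
            refine setLIntegral_mono' measurableSet_Ioc fun τ hτ => ?_
            refine le_trans ?_ (hg τ (hs.trans hτ.1) (hτ.2.trans_lt hs'T))
            rw [ENNReal.ofReal_mul hK.le, ← ENNReal.ofReal_rpow_of_nonneg hA.le (by linarith)]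
            gcongr
            exact hW.trans (lintegral_mono_set (Set.Ioc_subset_Ioc_right hτ.1.le))

theorem le_heatKernel {n : ℕ} {t b : ℝ} (ht : 0 < t) (htb : t ≤ b) {x : EuclideanSpace ℝ (Fin n)}
    (hx : ‖x‖ ^ 2 ≤ 4 * t) :
    (4 * Real.pi * b) ^ (-(n : ℝ) / 2) * Real.exp (-1) ≤ heatKernel n t x := by
  unfold heatKernel
  have h1 : (4 * Real.pi * b) ^ (-(n : ℝ) / 2) ≤ (4 * Real.pi * t) ^ (-(n : ℝ) / 2) := by
    apply Real.rpow_le_rpow_of_nonpos (by positivity) (by gcongr)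
    have : (0 : ℝ) ≤ n := n.cast_nonneg
    linarith
  have h2 : (-1 : ℝ) ≤ -‖x‖ ^ 2 / (4 * t) := by
    rw [le_div_iff₀ (by positivity)]; linarith
  gcongr

theorem exists_le_lintegral_heatENN_mul {n : ℕ} {u₀ : EuclideanSpace ℝ (Fin n) → ℝ≥0∞}
    (hu₀ : Measurable u₀) (hu₀pos : 0 < volume {x | 0 < u₀ x}) :
    ∃ c R : ℝ, 0 < c ∧ 0 < R ∧ ∀ s, R ≤ s → ∀ x : EuclideanSpace ℝ (Fin n), ‖x‖ ^ 2 ≤ s →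
      ENNReal.ofReal (c * s ^ (-(n : ℝ) / 2)) ≤ ∫⁻ y, heatENN n s (x - y) * u₀ y := by
  obtain ⟨k, hk⟩ : ∃ k : ℕ, ∫⁻ y in Metric.closedBall 0 (k : ℝ), u₀ y ≠ 0 := by
    by_contra! h
    have h2 : ∀ᵐ y, ∀ k : ℕ, y ∈ Metric.closedBall (0 : EuclideanSpace ℝ (Fin n)) (k : ℝ) →
        u₀ y = 0 := by
      rw [ae_all_iff]
      intro k
      rw [← ae_restrict_iff' Metric.isClosed_closedBall.measurableSet]
      exact (lintegral_eq_zero_iff hu₀).1 (h k)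
    refine hu₀pos.ne' (measure_mono_null (fun y hy => ?_) (ae_iff.1 h2))
    intro h3
    obtain ⟨k, hk⟩ := exists_nat_ge ‖y‖
    exact hy.ne' (h3 k (by simpa using hk))
  obtain ⟨m, hm0, hm⟩ : ∃ m : ℝ, 0 < m ∧
      ENNReal.ofReal m ≤ ∫⁻ y in Metric.closedBall 0 (k : ℝ), u₀ y := by
    obtain ⟨m, hm0, hm⟩ := ENNReal.lt_iff_exists_nnreal_btwn.1 (pos_iff_ne_zero.2 hk)
    exact ⟨m, by exact_mod_cast hm0, by simpa using hm.le⟩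
  refine ⟨(4 * Real.pi) ^ (-(n : ℝ) / 2) * Real.exp (-1) * m, (k : ℝ) ^ 2 + 1, by positivity,
    by positivity, fun s hs x hx => ?_⟩
  have hs0 : 0 < s := by nlinarith [sq_nonneg (k : ℝ)]
  calc ENNReal.ofReal ((4 * Real.pi) ^ (-(n : ℝ) / 2) * Real.exp (-1) * m * s ^ (-(n : ℝ) / 2))
      = ENNReal.ofReal ((4 * Real.pi * s) ^ (-(n : ℝ) / 2) * Real.exp (-1)) *
          ENNReal.ofReal m := by
        rw [← ENNReal.ofReal_mul (by positivity), Real.mul_rpow (by positivity) hs0.le]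
        congr 1
        ring
    _ ≤ ENNReal.ofReal ((4 * Real.pi * s) ^ (-(n : ℝ) / 2) * Real.exp (-1)) *
          ∫⁻ y in Metric.closedBall 0 (k : ℝ), u₀ y := by gcongr
    _ = ∫⁻ y in Metric.closedBall 0 (k : ℝ),
          ENNReal.ofReal ((4 * Real.pi * s) ^ (-(n : ℝ) / 2) * Real.exp (-1)) * u₀ y := by
        rw [lintegral_const_mul _ hu₀]
    _ ≤ ∫⁻ y in Metric.closedBall 0 (k : ℝ), heatENN n s (x - y) * u₀ y := by
        refine setLIntegral_mono' Metric.isClosed_closedBall.measurableSet fun y hy => ?_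
        gcongr
        refine ENNReal.ofReal_le_ofReal (le_heatKernel hs0 le_rfl ?_)
        have hy' : ‖y‖ ≤ k := by simpa using hy
        have h1 := norm_sub_le x y
        have h2 : ‖y‖ ^ 2 ≤ (k : ℝ) ^ 2 := by gcongr
        have h3 : ‖x - y‖ ^ 2 ≤ (‖x‖ + ‖y‖) ^ 2 := by gcongr
        nlinarith [sq_nonneg (‖x‖ - ‖y‖)]
    _ ≤ _ := setLIntegral_le_lintegral _ _

theorem lintegral_mul_lintegral_lintegral {α β γ : Type*} [MeasurableSpace α] [MeasurableSpace β]
    [MeasurableSpace γ] (μ : Measure α) (ν : Measure β) (ξ : Measure γ) [SFinite μ] [SFinite ν]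
    [SFinite ξ] {h : α → ℝ≥0∞} {F : α × β × γ → ℝ≥0∞} (hh : Measurable h) (hF : Measurable F) :
    ∫⁻ y, h y * ∫⁻ σ, ∫⁻ z, F (y, σ, z) ∂ξ ∂ν ∂μ =
      ∫⁻ σ, ∫⁻ z, ∫⁻ y, h y * F (y, σ, z) ∂μ ∂ξ ∂ν := by
  have hhF : Measurable (fun a : α × β × γ => h a.1 * F a) := (hh.comp measurable_fst).mul hF
  have hswap : Measurable (fun a : (β × γ) × α => h a.2 * F (a.2, a.1)) :=
    hhF.comp measurable_swap
  calc _ = ∫⁻ y, ∫⁻ a, h y * F (y, a) ∂(ν.prod ξ) ∂μ := by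
        refine lintegral_congr fun y => ?_
        have hFy : Measurable (fun a => F (y, a)) := hF.comp measurable_prodMk_left
        rw [lintegral_const_mul _ hFy, lintegral_prod _ hFy.aemeasurable]
    _ = ∫⁻ a, ∫⁻ y, h y * F (y, a) ∂μ ∂(ν.prod ξ) :=
        lintegral_lintegral_swap hhF.aemeasurable
    _ = _ := lintegral_prod _ hswap.lintegral_prod_right'.aemeasurable

/-- The heat flow from time `τ` to time `T` of the Duhamel integral of `w` up to time `τ`. -/
theorem lintegral_heatENN_mul_duhamel {n : ℕ} {w : ℝ → EuclideanSpace ℝ (Fin n) → ℝ≥0∞}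
    (hw : Measurable (Function.uncurry w)) {τ T : ℝ} (hτT : τ < T)
    (x : EuclideanSpace ℝ (Fin n)) :
    ∫⁻ y, heatENN n (T - τ) (x - y) *
        ∫⁻ σ in Set.Ioc 0 τ, ∫⁻ z, heatENN n (τ - σ) (y - z) * w σ z =
      ∫⁻ σ in Set.Ioc 0 τ, ∫⁻ z, heatENN n (T - σ) (x - z) * w σ z := by
  have hH : ∀ t, Measurable (heatENN n t) := fun t =>
    (measurable_heatENN n).comp measurable_prodMk_left
  have hF : Measurable (fun a : EuclideanSpace ℝ (Fin n) × ℝ × EuclideanSpace ℝ (Fin n) =>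
      heatENN n (τ - a.2.1) (a.1 - a.2.2) * w a.2.1 a.2.2) := by
    have h1 : Measurable (fun a : EuclideanSpace ℝ (Fin n) × ℝ × EuclideanSpace ℝ (Fin n) =>
      (τ - a.2.1, a.1 - a.2.2)) := by fun_prop
    exact ((measurable_heatENN n).comp h1).mul (hw.comp measurable_snd)
  have hh : Measurable (fun y => heatENN n (T - τ) (x - y)) := (hH _).comp (by fun_prop)
  rw [lintegral_mul_lintegral_lintegral _ _ _ hh hF, ← setLIntegral_congr Ioo_ae_eq_Ioc,
    ← setLIntegral_congr Ioo_ae_eq_Ioc]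
  refine setLIntegral_congr_fun measurableSet_Ioo fun σ hσ => lintegral_congr fun z => ?_
  have hh2 : Measurable (fun y => heatENN n (τ - σ) (y - z)) := (hH _).comp (by fun_prop)
  have hhh2 : Measurable (fun y => heatENN n (T - τ) (x - y) * heatENN n (τ - σ) (y - z)) :=
    hh.mul hh2
  simp_rw [← mul_assoc]
  rw [lintegral_mul_const _ hhh2,
    lintegral_heatENN_mul_heatENN (by linarith) (by linarith [hσ.2])]
  congr 2
  ring

/-- A supersolution of the heat equation with source `K * u ^ p` satisfies, after smoothing by the
heat flow up to time `T`, a differential inequality in time. -/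
theorem mul_rpow_duhamel_le {n : ℕ} {u : ℝ → EuclideanSpace ℝ (Fin n) → ℝ≥0∞}
    (hu : Measurable (Function.uncurry u)) {K p : ℝ} (hp : 1 ≤ p)
    (hge : ∀ t, 0 < t → ∀ x, ∫⁻ s in Set.Ioc 0 t, ∫⁻ y,
      heatENN n (t - s) (x - y) * (ENNReal.ofReal K * u s y ^ p) ≤ u t x)
    {τ T : ℝ} (hτ : 0 < τ) (hτT : τ < T) (x : EuclideanSpace ℝ (Fin n)) :
    ENNReal.ofReal K * (∫⁻ s in Set.Ioc 0 τ, ∫⁻ y,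
        heatENN n (T - s) (x - y) * (ENNReal.ofReal K * u s y ^ p)) ^ p ≤
      ∫⁻ y, heatENN n (T - τ) (x - y) * (ENNReal.ofReal K * u τ y ^ p) := by
  have hw : Measurable (Function.uncurry fun s y => ENNReal.ofReal K * u s y ^ p) :=
    (hu.pow_const p).const_mul _
  have hh : Measurable (fun y => heatENN n (T - τ) (x - y)) :=
    (measurable_heatENN n).comp (f := fun y => (T - τ, x - y)) (by fun_prop)
  have huτ : Measurable (u τ) := hu.of_uncurry_left
  rw [← lintegral_heatENN_mul_duhamel hw hτT]
  calc _ ≤ ENNReal.ofReal K * (∫⁻ y, heatENN n (T - τ) (x - y) * u τ y) ^ p := by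
        have hp0 : 0 ≤ p := by linarith
        gcongr with y
        exact hge τ hτ y
    _ ≤ ENNReal.ofReal K * ∫⁻ y, heatENN n (T - τ) (x - y) * u τ y ^ p := by
        gcongr
        exact rpow_lintegral_mul_le hp hh huτ (lintegral_heatENN (by linarith) x)
    _ = _ := by
        rw [← lintegral_const_mul _ (by fun_prop)]
        simp_rw [mul_left_comm]

theorem le_duhamel_of_le {n : ℕ} (hn : 1 ≤ n) {u : ℝ → EuclideanSpace ℝ (Fin n) → ℝ≥0∞}
    {K p c R : ℝ} (hK : 0 < K) (hp : p = 1 + 2 / n) (hc : 0 < c) (hR : 0 < R)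
    (hlow : ∀ s, R ≤ s → ∀ x : EuclideanSpace ℝ (Fin n), ‖x‖ ^ 2 ≤ s →
      ENNReal.ofReal (c * s ^ (-(n : ℝ) / 2)) ≤ u s x) :
    ∃ B : ℝ, 0 < B ∧ ∀ r T, R ≤ r → 2 * r ≤ T → T ≤ 3 * r → ∀ x : EuclideanSpace ℝ (Fin n),
      ‖x‖ ^ 2 ≤ r → ENNReal.ofReal (B * r ^ (-(n : ℝ) / 2) * Real.log (r / R)) ≤
        ∫⁻ s in Set.Ioc 0 r, ∫⁻ y,
          heatENN n (T - s) (x - y) * (ENNReal.ofReal K * u s y ^ p) := by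
  have hn0 : (0 : ℝ) < n := by exact_mod_cast hn
  have hp0 : 0 < p := by rw [hp]; positivity
  set V : ℝ := (volume (Metric.ball (0 : EuclideanSpace ℝ (Fin n)) 1)).toReal with hV
  have hVtop : volume (Metric.ball (0 : EuclideanSpace ℝ (Fin n)) 1) ≠ ⊤ := measure_ball_lt_top.ne
  have hV0 : 0 < V := ENNReal.toReal_pos (Metric.measure_ball_pos _ _ one_pos).ne' hVtop
  set B₀ : ℝ := (4 * Real.pi * 3) ^ (-(n : ℝ) / 2) * Real.exp (-1) with hB₀
  have hB₀0 : 0 < B₀ := by positivity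
  refine ⟨B₀ * (K * c ^ p) * V, by positivity, fun r T hr hT2 hT3 x hx => ?_⟩
  have hr0 : 0 < r := hR.trans_le hr
  set b : ℝ := B₀ * (K * c ^ p) * V * r ^ (-(n : ℝ) / 2) with hb
  have hb0 : 0 < b := by positivity
  have hpt : ∀ s ∈ Set.Ioc R r, ENNReal.ofReal (b * s⁻¹) ≤
      ∫⁻ y, heatENN n (T - s) (x - y) * (ENNReal.ofReal K * u s y ^ p) := by
    intro s hs
    have hs0 : 0 < s := hR.trans hs.1
    have hball : volume (Metric.closedBall (0 : EuclideanSpace ℝ (Fin n)) (√s)) =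
        ENNReal.ofReal (s ^ ((n : ℝ) / 2) * V) := by
      rw [Measure.addHaar_closedBall _ _ (Real.sqrt_nonneg s), finrank_euclideanSpace_fin,
        ENNReal.ofReal_mul (by positivity), hV, ENNReal.ofReal_toReal hVtop,
        Real.rpow_div_two_eq_sqrt _ hs0.le, Real.rpow_natCast]
    calc ENNReal.ofReal (b * s⁻¹)
        = ENNReal.ofReal (B₀ * r ^ (-(n : ℝ) / 2)) *
            (ENNReal.ofReal K * ENNReal.ofReal (c * s ^ (-(n : ℝ) / 2)) ^ p) *
            volume (Metric.closedBall (0 : EuclideanSpace ℝ (Fin n)) (√s)) := by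
          rw [hball, ENNReal.ofReal_rpow_of_nonneg (by positivity) hp0.le,
            ← ENNReal.ofReal_mul (by positivity), ← ENNReal.ofReal_mul (by positivity),
            ← ENNReal.ofReal_mul (by positivity)]
          congr 1
          rw [Real.mul_rpow (by positivity) (by positivity), ← Real.rpow_mul hs0.le]
          have e : s⁻¹ = s ^ (-(n : ℝ) / 2 * p) * s ^ ((n : ℝ) / 2) := by
            rw [← Real.rpow_add hs0, ← Real.rpow_neg_one]
            congr 1
            rw [hp]; field_simp; ring
          rw [e, hb]
          ring
      _ = ∫⁻ _ in Metric.closedBall (0 : EuclideanSpace ℝ (Fin n)) (√s),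
            ENNReal.ofReal (B₀ * r ^ (-(n : ℝ) / 2)) *
            (ENNReal.ofReal K * ENNReal.ofReal (c * s ^ (-(n : ℝ) / 2)) ^ p) := by
          rw [setLIntegral_const]
      _ ≤ ∫⁻ y in Metric.closedBall (0 : EuclideanSpace ℝ (Fin n)) (√s),
            heatENN n (T - s) (x - y) * (ENNReal.ofReal K * u s y ^ p) := by
          refine setLIntegral_mono' Metric.isClosed_closedBall.measurableSet fun y hy => ?_
          have hy' : ‖y‖ ≤ √s := by simpa using hy
          have hy2 : ‖y‖ ^ 2 ≤ s := by
            rw [← Real.sq_sqrt hs0.le]; gcongr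
          gcongr
          · have hb1 : B₀ * r ^ (-(n : ℝ) / 2) =
                (4 * Real.pi * (3 * r)) ^ (-(n : ℝ) / 2) * Real.exp (-1) := by
              rw [← mul_assoc, Real.mul_rpow (by positivity) hr0.le, hB₀]
              ring
            rw [hb1]
            refine ENNReal.ofReal_le_ofReal (le_heatKernel (by linarith [hs.2]) (by linarith) ?_)
            have h3 : ‖x - y‖ ^ 2 ≤ (‖x‖ + ‖y‖) ^ 2 := by gcongr; exact norm_sub_le x y
            nlinarith [sq_nonneg (‖x‖ - ‖y‖), hs.2]
          · exact hlow s hs.1.le y hy2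
      _ ≤ _ := setLIntegral_le_lintegral _ _
  calc ENNReal.ofReal (b * Real.log (r / R))
      = ∫⁻ s in Set.Ioc R r, ENNReal.ofReal (b * s⁻¹) := by
        rw [← integral_inv_of_pos hR hr0, ← intervalIntegral.integral_const_mul,
          intervalIntegral.integral_of_le hr, ofReal_integral_eq_lintegral_ofReal]
        · refine (intervalIntegrable_iff_integrableOn_Ioc_of_le hr).1 ?_
          refine (intervalIntegral.intervalIntegrable_inv (fun s hs => ?_)
            continuousOn_id).const_mul b
          rw [Set.uIcc_of_le hr] at hs
          exact (hR.trans_le hs.1).ne'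
        · refine (ae_restrict_iff' measurableSet_Ioc).2 (.of_forall fun s hs => ?_)
          have : 0 < s := hR.trans hs.1
          simp only [Pi.zero_apply]
          positivity
    _ ≤ ∫⁻ s in Set.Ioc R r, ∫⁻ y,
          heatENN n (T - s) (x - y) * (ENNReal.ofReal K * u s y ^ p) :=
        setLIntegral_mono' measurableSet_Ioc hpt
    _ ≤ _ := lintegral_mono_set (Set.Ioc_subset_Ioc_left hR.le)

/-- Blow-up on a space-time cylinder of supersolutions with Gaussian lower bounds. -/
theorem exists_eq_top_of_supersolution {n : ℕ} (hn : 1 ≤ n)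
    {u : ℝ → EuclideanSpace ℝ (Fin n) → ℝ≥0∞}
    (hu : Measurable (Function.uncurry u)) {K p c R : ℝ} (hK : 0 < K) (hp : p = 1 + 2 / n)
    (hc : 0 < c) (hR : 0 < R)
    (hge : ∀ t, 0 < t → ∀ x, ∫⁻ s in Set.Ioc 0 t, ∫⁻ y,
      heatENN n (t - s) (x - y) * (ENNReal.ofReal K * u s y ^ p) ≤ u t x)
    (hlow : ∀ s, R ≤ s → ∀ x : EuclideanSpace ℝ (Fin n), ‖x‖ ^ 2 ≤ s →
      ENNReal.ofReal (c * s ^ (-(n : ℝ) / 2)) ≤ u s x) :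
    ∃ r, 0 < r ∧ ∀ T ∈ Set.Icc (2 * r) (3 * r), ∀ x ∈ Metric.closedBall 0 (√r), u T x = ⊤ := by
  have hn0 : (0 : ℝ) < n := by exact_mod_cast hn
  obtain ⟨B, hB, hBW⟩ := le_duhamel_of_le hn hK hp hc hR hlow
  set q : ℝ := 2 / n with hq
  have hq0 : 0 < q := by positivity
  have hρ : (0 : ℝ) < 1 - 2 ^ (-q) := by
    have : (2 : ℝ) ^ (-q) < 1 := Real.rpow_lt_one_of_one_lt_of_neg (by norm_num) (by linarith)
    linarith
  set D : ℝ := K * B ^ q * (1 - 2 ^ (-q)) with hD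
  have hD0 : 0 < D := by positivity
  set L : ℝ := D⁻¹ ^ (1 / q) with hL
  have hL0 : 0 < L := by positivity
  have hLq : L ^ q = D⁻¹ := by
    rw [hL, ← Real.rpow_mul (by positivity), one_div_mul_cancel hq0.ne', Real.rpow_one]
  set r : ℝ := R * Real.exp L with hr
  have hr0 : 0 < r := by positivity
  have hRr : R ≤ r := by
    have : 1 ≤ Real.exp L := Real.one_le_exp hL0.le
    nlinarith
  have hlog : Real.log (r / R) = L := by
    rw [hr, mul_div_cancel_left₀ _ hR.ne', Real.log_exp]
  refine ⟨r, hr0, fun T hT x hx => ?_⟩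
  have hx2 : ‖x‖ ^ 2 ≤ r := by
    have : ‖x‖ ≤ √r := by simpa using hx
    rw [← Real.sq_sqrt hr0.le]; gcongr
  have hW := hBW r T hRr hT.1 hT.2 x hx2
  rw [hlog] at hW
  set A : ℝ := B * r ^ (-(n : ℝ) / 2) * L with hA
  have hA0 : 0 < A := by positivity
  have hAq : A ^ q = B ^ q * r⁻¹ * D⁻¹ := by
    rw [hA, Real.mul_rpow (by positivity) hL0.le, Real.mul_rpow hB.le (by positivity), hLq,
      ← Real.rpow_mul hr0.le, ← Real.rpow_neg_one r]
    congr 3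
    rw [hq]; field_simp
  have hA1 : 1 ≤ K * A ^ q * (T - r) * (1 - 2 ^ (-q)) := by
    have e : K * A ^ q * (T - r) * (1 - 2 ^ (-q)) = (T - r) / r := by
      rw [hAq]
      calc _ = D * D⁻¹ * ((T - r) / r) := by rw [hD]; ring
        _ = _ := by rw [mul_inv_cancel₀ hD0.ne', one_mul]
    rw [e, le_div_iff₀ hr0]
    linarith [hT.1]
  have hp1 : 1 ≤ p := by rw [hp]; linarith
  have hblow : ∀ k : ℕ, ENNReal.ofReal (2 ^ k * A) ≤ u T x := fun k =>
    (ofReal_two_pow_mul_le_lintegral_Ioc (T := T) hK hq0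
      (fun τ hτ hτT => by rw [← hp]; exact mul_rpow_duhamel_le hu hp1 hge hτ hτT x)
      k r A hr0 (by linarith [hT.1]) hA0 hA1 hW).trans (hge T (by linarith [hT.1]) x)
  have hlim : Filter.Tendsto (fun k : ℕ => ENNReal.ofReal (2 ^ k * A)) Filter.atTop (nhds ⊤) :=
    ENNReal.tendsto_ofReal_atTop.comp
      ((tendsto_pow_atTop_atTop_of_one_lt (by norm_num)).atTop_mul_const hA0)
  exact top_le_iff.1 (le_of_tendsto' hlim hblow)

theorem no_global_solution_critical
    (n : ℕ) (hn : 1 ≤ n) (p K₂ : ℝ) (hp : p = 1 + 2 / n) (hK₂ : 0 < K₂)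
    (f : ℝ → ℝ) (hf0 : ∀ u ≥ (0 : ℝ), 0 ≤ f u)
    (hfloc : LocallyIntegrableOn f (Set.Ici 0) volume)
    (hfK : ∀ u ≥ (0 : ℝ), K₂ * u ^ p ≤ f u)
    (u₀ : EuclideanSpace ℝ (Fin n) → ℝ≥0∞) (hu₀ : Measurable u₀)
    (hu₀pos : 0 < volume {x | 0 < u₀ x}) :
    ¬ ∃ u : ℝ → EuclideanSpace ℝ (Fin n) → ℝ≥0∞,
      Measurable (Function.uncurry u) ∧
      (∀ᵐ q ∂((volume.restrict (Set.Ioi (0 : ℝ))).prod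
          (volume : Measure (EuclideanSpace ℝ (Fin n)))), u q.1 q.2 < ⊤) ∧
      (∀ t : ℝ, 0 < t → ∀ x : EuclideanSpace ℝ (Fin n),
        u t x = (∫⁻ y, ENNReal.ofReal (heatKernel n t (x - y)) * u₀ y)
          + ∫⁻ s in Set.Ioc (0 : ℝ) t,
              ∫⁻ y, ENNReal.ofReal (heatKernel n (t - s) (x - y))
                * ENNReal.ofReal (f ((u s y).toReal))) := by
  rintro ⟨u, hu, hfin, hsol⟩
  have hp0 : 0 ≤ p := by rw [hp]; positivity
  have hge : ∀ t, 0 < t → ∀ x, ∫⁻ s in Set.Ioc 0 t, ∫⁻ y,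
      heatENN n (t - s) (x - y) * (ENNReal.ofReal K₂ * u s y ^ p) ≤ u t x := by
    intro t ht x
    rw [hsol t ht x]
    refine le_trans (lintegral_mono_ae ?_) le_add_self
    filter_upwards [ae_restrict_of_ae_restrict_of_subset
      (fun s hs => hs.1 : Set.Ioc 0 t ⊆ Set.Ioi 0) (Measure.ae_ae_of_ae_prod hfin)] with s hs
    refine lintegral_mono_ae ?_
    filter_upwards [hs] with y hy
    unfold heatENN
    gcongr
    refine le_trans (le_of_eq ?_) (ENNReal.ofReal_le_ofReal (hfK _ ENNReal.toReal_nonneg))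
    rw [ENNReal.ofReal_mul hK₂.le, ← ENNReal.ofReal_rpow_of_nonneg ENNReal.toReal_nonneg hp0,
      ENNReal.ofReal_toReal hy.ne]
  obtain ⟨c, R, hc, hR, hlow⟩ := exists_le_lintegral_heatENN_mul hu₀ hu₀pos
  obtain ⟨r, hr, htop⟩ := exists_eq_top_of_supersolution hn hu hK₂ hp hc hR hge
    fun s hs x hx => by
      rw [hsol s (hR.trans_le hs) x]
      exact (hlow s hs x hx).trans le_self_add
  have hne : (volume.restrict (Set.Ioi (0 : ℝ))) (Set.Icc (2 * r) (3 * r)) ≠ 0 := by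
    have hsub : Set.Icc (2 * r) (3 * r) ⊆ Set.Ioi 0 := fun T hT =>
      lt_of_lt_of_le (by positivity) hT.1
    rw [Measure.restrict_apply measurableSet_Icc, Set.inter_eq_left.2 hsub, Real.volume_Icc]
    simp only [ne_eq, ENNReal.ofReal_eq_zero, not_le]
    linarith
  refine hne (measure_mono_null (fun T hT => ?_) (ae_iff.1 (Measure.ae_ae_of_ae_prod hfin)))
  intro hT'
  refine (Metric.measure_closedBall_pos (volume : Measure (EuclideanSpace ℝ (Fin n))) 0
    (Real.sqrt_pos.2 hr)).ne' (measure_mono_null (fun x hx => ?_) (ae_iff.1 hT'))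
  intro hx'
  exact hx'.ne (htop T hT x hx)
end
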